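/- Let G be a connected unbalanced signed graph with a fixed orientation, and suppose there is an edge e such that G − e is balanced. Then for every finite additive abelian group Γ of odd order, G has no nowhere-zero Γ-flow. -/

import Mathlib

/-- A signed graph: each edge `e` has endpoints `a e`, `b e` (equal for a loop)
and a sign `sign e ∈ {1, -1}`. -/
structure SignedGraph (V E : Type) where
  a : E → V
  b : E → V
  sign : E → ℤ
  sign_unit : ∀ e, sign e = 1 ∨ sign e = -1

namespace SignedGraph

variable {V E : Type}

/-- An orientation of a signed graph: incidence signs `ηa e`, `ηb e ∈ {1,-1}` at the
two ends of each edge, with `ηa e * ηb e = - sign e`. -/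
structure Orientation (G : SignedGraph V E) where
  ηa : E → ℤ
  ηb : E → ℤ
  ηa_unit : ∀ e, ηa e = 1 ∨ ηa e = -1
  ηb_unit : ∀ e, ηb e = 1 ∨ ηb e = -1
  compat : ∀ e, ηa e * ηb e = - G.sign e

/-- Kirchhoff's law at every vertex: a `Γ`-flow. -/
def IsFlow [Fintype E] [DecidableEq V] {Γ : Type} [AddCommGroup Γ]
    (G : SignedGraph V E) (O : G.Orientation) (f : E → Γ) : Prop :=
  ∀ v : V, ∑ e : E,
    ((if G.a e = v then O.ηa e else 0) + (if G.b e = v then O.ηb e else 0)) • f e = 0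

/-- Degree of a vertex in the subgraph with edge set `S` (a loop counts twice). -/
def deg [DecidableEq V] (G : SignedGraph V E) (S : Finset E) (v : V) : ℕ :=
  ∑ e ∈ S, ((if G.a e = v then 1 else 0) + (if G.b e = v then 1 else 0))

/-- Adjacency via an edge in the edge set `S`. -/
def AdjIn (G : SignedGraph V E) (S : Finset E) (v w : V) : Prop :=
  ∃ e ∈ S, (G.a e = v ∧ G.b e = w) ∨ (G.a e = w ∧ G.b e = v)

/-- A circuit: a nonempty edge set forming a connected 2-regular subgraph. -/
def IsCircuit [DecidableEq V] (G : SignedGraph V E) (C : Finset E) : Prop :=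
  C.Nonempty ∧
  (∀ v : V, (∃ e ∈ C, G.a e = v ∨ G.b e = v) → G.deg C v = 2) ∧
  (∀ v w : V, (∃ e ∈ C, G.a e = v ∨ G.b e = v) → (∃ e ∈ C, G.a e = w ∨ G.b e = w) →
     Relation.ReflTransGen (G.AdjIn C) v w)

/-- An unbalanced circuit: a circuit with an odd number of negative edges. -/
def IsUnbalancedCircuit [DecidableEq V] (G : SignedGraph V E) (C : Finset E) : Prop :=
  G.IsCircuit C ∧ Odd (C.filter (fun e => G.sign e = -1)).card

/-- The subgraph with edge set `S` is balanced (contains no unbalanced circuit). -/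
def BalancedOn [DecidableEq V] (G : SignedGraph V E) (S : Finset E) : Prop :=
  ∀ C : Finset E, C ⊆ S → ¬ G.IsUnbalancedCircuit C

/-- A balanced signed graph: contains no unbalanced circuit. -/
def Balanced [DecidableEq V] (G : SignedGraph V E) : Prop :=
  ∀ C : Finset E, ¬ G.IsUnbalancedCircuit C

/-- An unbalanced signed graph: contains an unbalanced circuit. -/
def Unbalanced [DecidableEq V] (G : SignedGraph V E) : Prop :=
  ∃ C : Finset E, G.IsUnbalancedCircuit C

/-- Adjacency in the whole signed graph. -/
def Adj (G : SignedGraph V E) (v w : V) : Prop :=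
  ∃ e : E, (G.a e = v ∧ G.b e = w) ∨ (G.a e = w ∧ G.b e = v)

/-- A connected signed graph: every two vertices are joined by a walk. -/
def Connected (G : SignedGraph V E) : Prop :=
  ∀ v w : V, Relation.ReflTransGen G.Adj v w

/-- The setoid on vertices whose classes are the connected components. -/
def compSetoid (G : SignedGraph V E) : Setoid V :=
  ⟨Relation.EqvGen G.Adj, Relation.EqvGen.is_equivalence _⟩

/-- The connected component of a vertex. -/
def component (G : SignedGraph V E) (v : V) : Quotient G.compSetoid :=
  Quotient.mk G.compSetoid v

/-- The number of vertices of a connected component. -/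
noncomputable def compN (G : SignedGraph V E) (q : Quotient G.compSetoid) : ℕ :=
  Nat.card {v : V // G.component v = q}

/-- The number of edges of a connected component. -/
noncomputable def compM (G : SignedGraph V E) (q : Quotient G.compSetoid) : ℕ :=
  Nat.card {e : E // G.component (G.a e) = q}

/-- The connected component `q` is unbalanced (contains an unbalanced circuit). -/
def CompUnbalanced [DecidableEq V] (G : SignedGraph V E) (q : Quotient G.compSetoid) : Prop :=
  ∃ C : Finset E, G.IsUnbalancedCircuit C ∧ ∃ e ∈ C, G.component (G.a e) = q

open Classical in
/-- `β` of a connected component: `m - n` if unbalanced, `m - n + 1` if balanced. -/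
noncomputable def compBeta [DecidableEq V] (G : SignedGraph V E)
    (q : Quotient G.compSetoid) : ℕ :=
  if G.CompUnbalanced q then G.compM q - G.compN q else G.compM q + 1 - G.compN q

/-- `β(G)`: the sum of `β(ω)` over the connected components `ω` of `G`. -/
noncomputable def beta [DecidableEq V] (G : SignedGraph V E) : ℕ :=
  ∑ᶠ q : Quotient G.compSetoid, G.compBeta q

/-- `κ(G)`: the number of unbalanced connected components of `G`. -/
noncomputable def kappa [DecidableEq V] (G : SignedGraph V E) : ℕ :=
  Nat.card {q : Quotient G.compSetoid // G.CompUnbalanced q}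

/-- The signed graph `G - F` obtained by deleting the edges in `F` (all vertices kept). -/
def delete [DecidableEq E] (G : SignedGraph V E) (F : Finset E) :
    SignedGraph V {e : E // e ∉ F} :=
  ⟨fun e => G.a e.1, fun e => G.b e.1, fun e => G.sign e.1, fun e => G.sign_unit e.1⟩

/-- The edges with both endpoints in `X` (the edge set of `G[X]`). -/
def insideEdges [Fintype E] [DecidableEq V] (G : SignedGraph V E) (X : Finset V) : Finset E :=
  Finset.univ.filter (fun e => G.a e ∈ X ∧ G.b e ∈ X)

/-- The edges with one endpoint in `X` and one outside: `[X, Xᶜ]`. -/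
def crossEdges [Fintype E] [DecidableEq V] (G : SignedGraph V E) (X : Finset V) : Finset E :=
  Finset.univ.filter (fun e => (G.a e ∈ X ∧ G.b e ∉ X) ∨ (G.a e ∉ X ∧ G.b e ∈ X))

/-- A cut: a nonempty set `B = [X, Xᶜ] ∪ E_X` where `X` is a nonempty vertex set and `E_X`
is a set of edges of `G[X]` minimal with `G[X] - E_X` balanced. -/
def IsCut [Fintype E] [DecidableEq V] [DecidableEq E]
    (G : SignedGraph V E) (B : Finset E) : Prop :=
  B.Nonempty ∧ ∃ X : Finset V, X.Nonempty ∧ ∃ EX : Finset E,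
    EX ⊆ G.insideEdges X ∧
    G.BalancedOn (G.insideEdges X \ EX) ∧
    (∀ EX' ⊆ EX, G.BalancedOn (G.insideEdges X \ EX') → EX' = EX) ∧
    B = G.crossEdges X ∪ EX

/-- A bond: a cut that is minimal (under inclusion) among cuts. -/
def IsBond [Fintype E] [DecidableEq V] [DecidableEq E]
    (G : SignedGraph V E) (B : Finset E) : Prop :=
  G.IsCut B ∧ ∀ B' ⊆ B, G.IsCut B' → B' = B

/-- A broken bond: a bond minus its largest edge (w.r.t. the linear order on `E`). -/
def IsBrokenBond [Fintype E] [DecidableEq V] [LinearOrder E]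
    (G : SignedGraph V E) (D : Finset E) : Prop :=
  ∃ B : Finset E, G.IsBond B ∧ ∃ h : B.Nonempty, D = B.erase (B.max' h)

/-- `F` contains no broken bond of `G` as a subset. -/
def NoBrokenBond [Fintype E] [DecidableEq V] [LinearOrder E]
    (G : SignedGraph V E) (F : Finset E) : Prop :=
  ∀ D : Finset E, G.IsBrokenBond D → ¬ D ⊆ F

end SignedGraph

/-- `ε(Γ)`: the largest `d` such that `Γ` has a subgroup isomorphic to `(ℤ/2ℤ)^d`. -/
noncomputable def epsilon (Γ : Type) [AddCommGroup Γ] [Fintype Γ] : ℕ :=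
  sSup {d : ℕ | ∃ H : AddSubgroup Γ, Nonempty (H ≃+ (Fin d → ZMod 2))}

namespace SignedGraph

variable {V E : Type}

/-- An edge set all of whose vertex degrees are even. -/
def IsEvenSet [DecidableEq V] (G : SignedGraph V E) (S : Finset E) : Prop :=
  ∀ v, Even (G.deg S v)

lemma sum_deg [Fintype V] [DecidableEq V] (G : SignedGraph V E) (S : Finset E) :
    ∑ v, G.deg S v = 2 * S.card := by
  simp only [deg]
  rw [Finset.sum_comm]
  simp [Finset.sum_add_distrib]
  ring

lemma deg_mono [DecidableEq V] (G : SignedGraph V E) {S T : Finset E} (h : S ⊆ T) (v : V) :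
    G.deg S v ≤ G.deg T v :=
  Finset.sum_le_sum_of_subset h

lemma deg_sdiff_add [DecidableEq V] [DecidableEq E] (G : SignedGraph V E) {S T : Finset E}
    (h : S ⊆ T) (v : V) : G.deg (T \ S) v + G.deg S v = G.deg T v :=
  Finset.sum_sdiff h

lemma IsEvenSet.sdiff [DecidableEq V] [DecidableEq E] {G : SignedGraph V E} {S T : Finset E}
    (hT : G.IsEvenSet T) (hS : G.IsEvenSet S) (h : S ⊆ T) : G.IsEvenSet (T \ S) := by
  intro v
  have h₁ := G.deg_sdiff_add h v
  have h₂ := hT v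
  rw [← h₁] at h₂
  exact (Nat.even_add.mp h₂).mpr (hS v)

lemma even_deg_symmDiff [DecidableEq V] [DecidableEq E] (G : SignedGraph V E) {S T : Finset E}
    {v : V} (h : Even (G.deg S v) ↔ Even (G.deg T v)) : Even (G.deg (symmDiff S T) v) := by
  have h₁ := G.deg_sdiff_add (Finset.inter_subset_left : S ∩ T ⊆ S) v
  have h₂ := G.deg_sdiff_add (Finset.inter_subset_right : S ∩ T ⊆ T) v
  rw [Finset.sdiff_inter_self_left] at h₁
  rw [Finset.sdiff_inter_self_right] at h₂
  have h₃ : G.deg (symmDiff S T) v = G.deg (S \ T) v + G.deg (T \ S) v :=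
    Finset.sum_union disjoint_sdiff_sdiff
  rw [h₃]
  rw [← h₁, ← h₂] at h
  simp only [Nat.even_add] at h ⊢
  tauto

lemma deg_ne_zero_iff [DecidableEq V] (G : SignedGraph V E) {S : Finset E} {v : V} :
    G.deg S v ≠ 0 ↔ ∃ e ∈ S, G.a e = v ∨ G.b e = v := by
  simp only [deg, ne_eq, Finset.sum_eq_zero_iff, not_forall]
  constructor
  · rintro ⟨e, he, h⟩
    refine ⟨e, he, ?_⟩
    by_contra hc
    push Not at hc
    simp [hc.1, hc.2] at h
  · rintro ⟨e, he, h⟩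
    refine ⟨e, he, ?_⟩
    rcases h with h | h <;> simp [h]

lemma deg_eq_two_of_minimal_isEvenSet [Fintype V] [DecidableEq V] [DecidableEq E]
    (G : SignedGraph V E) {T : Finset E} (hT : G.IsEvenSet T)
    (hmin : ∀ S ⊆ T, S.Nonempty → G.IsEvenSet S → S = T) {v : V} (hv : G.deg T v ≠ 0) :
    G.deg T v = 2 := by
  by_contra hne
  obtain ⟨e₀, he₀, -⟩ := G.deg_ne_zero_iff.mp hv
  set W : Finset V := Finset.univ.filter (fun w => G.deg T w ≠ 0) with hW
  have hvW : v ∈ W := by simp [hW, hv]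
  have two_le : ∀ w ∈ W, 2 ≤ G.deg T w := by
    intro w hw
    have h₁ : G.deg T w ≠ 0 := (Finset.mem_filter.mp hw).2
    obtain ⟨k, hk⟩ := hT w
    omega
  have hsum : ∑ w ∈ W, G.deg T w = 2 * T.card := by
    rw [← G.sum_deg T, hW, Finset.sum_filter_ne_zero]
  have hlt : ∑ w ∈ W, 2 < ∑ w ∈ W, G.deg T w :=
    Finset.sum_lt_sum two_le ⟨v, hvW, lt_of_le_of_ne (two_le v hvW) (Ne.symm hne)⟩
  rw [hsum, Finset.sum_const, smul_eq_mul] at hlt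
  have hWpos : 0 < W.card := Finset.card_pos.mpr ⟨v, hvW⟩
  -- more subsets of `T.erase e₀` than parity patterns on `W.erase v`
  obtain ⟨S₁, hS₁, S₂, hS₂, hS, heq⟩ :=
    Finset.exists_ne_map_eq_of_card_lt_of_maps_to
      (s := (T.erase e₀).powerset) (t := (W.erase v).powerset)
      (f := fun S => (W.erase v).filter (fun w => Even (G.deg S w)))
      (by
        rw [Finset.card_powerset, Finset.card_powerset, Finset.card_erase_of_mem he₀,
          Finset.card_erase_of_mem hvW]
        exact Nat.pow_lt_pow_right (by norm_num) (by omega))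
      (fun S _ => Finset.mem_coe.mpr (Finset.mem_powerset.mpr (Finset.filter_subset _ _)))
  rw [Finset.mem_powerset] at hS₁ hS₂
  have hsub : symmDiff S₁ S₂ ⊆ T.erase e₀ := by
    intro e he
    rcases Finset.mem_symmDiff.mp he with h | h
    · exact hS₁ h.1
    · exact hS₂ h.1
  have hsubT := hsub.trans (Finset.erase_subset _ _)
  have heven : ∀ w, w ≠ v → Even (G.deg (symmDiff S₁ S₂) w) := by
    intro w hwv
    by_cases hw : w ∈ W
    · refine G.even_deg_symmDiff ?_
      have := Finset.ext_iff.mp heq w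
      simpa [hwv, hw] using this
    · have h₀ : G.deg T w = 0 := by simpa [hW] using hw
      have h₁ := G.deg_mono hsubT w
      rw [h₀, Nat.le_zero] at h₁
      rw [h₁]
      exact Even.zero
  have hEvenSet : G.IsEvenSet (symmDiff S₁ S₂) := by
    intro w
    by_cases hwv : w = v
    · subst hwv
      have h₁ := G.sum_deg (symmDiff S₁ S₂)
      rw [← Finset.add_sum_erase _ _ (Finset.mem_univ w)] at h₁
      have h₂ : Even (∑ u ∈ Finset.univ.erase w, G.deg (symmDiff S₁ S₂) u) :=
        Finset.even_sum _ (fun u hu => heven u (Finset.ne_of_mem_erase hu))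
      have h₃ : Even (2 * (symmDiff S₁ S₂).card) := even_two_mul _
      rw [← h₁] at h₃
      exact (Nat.even_add.mp h₃).mpr h₂
    · exact heven w hwv
  have hT' := hmin _ hsubT (Finset.nonempty_iff_ne_empty.mpr
    (fun h => hS (symmDiff_eq_bot.mp h))) hEvenSet
  exact Finset.notMem_erase e₀ T (hsub (hT' ▸ he₀))

lemma isCircuit_of_minimal_isEvenSet [Fintype V] [DecidableEq V] [DecidableEq E]
    (G : SignedGraph V E) {T : Finset E} (hne : T.Nonempty) (hT : G.IsEvenSet T)
    (hmin : ∀ S ⊆ T, S.Nonempty → G.IsEvenSet S → S = T) : G.IsCircuit T := by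
  classical
  refine ⟨hne, fun v hv => G.deg_eq_two_of_minimal_isEvenSet hT hmin
    (G.deg_ne_zero_iff.mpr hv), ?_⟩
  rintro v w ⟨e, he, hev⟩ ⟨e', he', hew⟩
  set R := Relation.ReflTransGen (G.AdjIn T) v
  have hab : ∀ f ∈ T, (R (G.a f) ↔ R (G.b f)) := fun f hf =>
    ⟨fun h => h.tail ⟨f, hf, Or.inl ⟨rfl, rfl⟩⟩, fun h => h.tail ⟨f, hf, Or.inr ⟨rfl, rfl⟩⟩⟩
  have hRv : R v := Relation.ReflTransGen.refl
  have hEven : G.IsEvenSet (T.filter (fun f => R (G.a f))) := by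
    intro u
    by_cases hu : R u
    · have : G.deg (T.filter (fun f => R (G.a f))) u = G.deg T u := by
        refine Finset.sum_subset (Finset.filter_subset _ _) fun f hf hf' => ?_
        have h₁ : ¬ R (G.a f) := fun h => hf' (Finset.mem_filter.mpr ⟨hf, h⟩)
        have h₂ : ¬ R (G.b f) := fun h => h₁ ((hab f hf).mpr h)
        rw [if_neg (fun h : G.a f = u => h₁ (h ▸ hu)),
          if_neg (fun h : G.b f = u => h₂ (h ▸ hu)), add_zero]
      rw [this]
      exact hT u
    · have : G.deg (T.filter (fun f => R (G.a f))) u = 0 := by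
        by_contra h
        obtain ⟨f, hf, h⟩ := G.deg_ne_zero_iff.mp h
        obtain ⟨hfT, hfR⟩ := Finset.mem_filter.mp hf
        rcases h with h | h
        · exact hu (h ▸ hfR)
        · exact hu (h ▸ (hab f hfT).mp hfR)
      rw [this]
      exact Even.zero
  have heR : R (G.a e) := by
    rcases hev with h | h
    · exact h ▸ hRv
    · exact (hab e he).mpr (h ▸ hRv)
  have hfull := hmin _ (Finset.filter_subset _ _) ⟨e, Finset.mem_filter.mpr ⟨he, heR⟩⟩ hEven
  rw [← hfull] at he'
  obtain ⟨he'T, he'R⟩ := Finset.mem_filter.mp he'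
  rcases hew with h | h
  · exact h ▸ he'R
  · exact h ▸ (hab e' he'T).mp he'R

lemma exists_isUnbalancedCircuit_of_isEvenSet [Fintype V] [DecidableEq V] (G : SignedGraph V E)
    (T : Finset E) (hT : G.IsEvenSet T)
    (hodd : Odd (T.filter (fun e => G.sign e = -1)).card) :
    ∃ C, G.IsUnbalancedCircuit C := by
  classical
  induction T using Finset.strongInduction with
  | H T ih =>
    by_cases hmin : ∀ S ⊆ T, S.Nonempty → G.IsEvenSet S → S = T
    · refine ⟨T, G.isCircuit_of_minimal_isEvenSet ?_ hT hmin, hodd⟩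
      rw [Finset.nonempty_iff_ne_empty]
      rintro rfl
      simp at hodd
    · push Not at hmin
      obtain ⟨S, hST, hSne, hS, hne⟩ := hmin
      by_cases hSodd : Odd (S.filter (fun e => G.sign e = -1)).card
      · exact ih S (lt_of_le_of_ne hST hne) hS hSodd
      · refine ih (T \ S) (Finset.sdiff_ssubset hST hSne) (hT.sdiff hS hST) ?_
        have hcard : ((T \ S).filter (fun e => G.sign e = -1)).card
            + (S.filter (fun e => G.sign e = -1)).card
            = (T.filter (fun e => G.sign e = -1)).card := by
          simp only [Finset.card_filter]
          exact Finset.sum_sdiff hST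
        rw [← hcard, Nat.odd_add] at hodd
        exact hodd.mpr (Nat.not_odd_iff_even.mp hSodd)

/-- The mod 2 boundary map, from edge chains to vertex chains. -/
def boundary [Fintype E] [DecidableEq V] (G : SignedGraph V E) :
    (E → ZMod 2) →ₗ[ZMod 2] (V → ZMod 2) where
  toFun y v := ∑ e, y e * ((if G.a e = v then 1 else 0) + (if G.b e = v then 1 else 0))
  map_add' y z := by
    ext v
    simp [add_mul, Finset.sum_add_distrib]
  map_smul' c y := by
    ext v
    simp [Finset.mul_sum, mul_assoc]

/-- The functional counting, mod 2, the negative edges of an edge chain. -/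
def negCount [Fintype E] (G : SignedGraph V E) : (E → ZMod 2) →ₗ[ZMod 2] ZMod 2 where
  toFun y := ∑ e, y e * (if G.sign e = -1 then 1 else 0)
  map_add' y z := by simp only [Pi.add_apply, add_mul, Finset.sum_add_distrib]
  map_smul' c y := by
    simp only [Pi.smul_apply, smul_eq_mul, Finset.mul_sum, mul_assoc, RingHom.id_apply]

lemma negCount_eq_zero_of_balanced [Fintype V] [Fintype E] [DecidableEq V]
    {G : SignedGraph V E} (hG : G.Balanced) {y : E → ZMod 2} (hy : G.boundary y = 0) :
    G.negCount y = 0 := by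
  have hval : ∀ e, y e = if y e = 1 then 1 else 0 := by
    intro e
    generalize y e = c
    revert c
    decide
  set T : Finset E := Finset.univ.filter (fun e => y e = 1) with hTdef
  have hT : G.IsEvenSet T := by
    intro v
    rw [← ZMod.natCast_eq_zero_iff_even]
    have h := congrFun hy v
    rw [Pi.zero_apply] at h
    rw [← h]
    change _ = ∑ e, y e * ((if G.a e = v then 1 else 0) + (if G.b e = v then 1 else 0))
    simp only [deg, hTdef, Finset.sum_filter]
    push_cast
    refine Finset.sum_congr rfl fun e _ => ?_
    conv_rhs => rw [hval e]
    split_ifs <;> simp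
  have hcount : ((T.filter (fun e => G.sign e = -1)).card : ZMod 2) = G.negCount y := by
    change _ = ∑ e, y e * (if G.sign e = -1 then 1 else 0)
    rw [Finset.card_filter, hTdef, Finset.sum_filter]
    push_cast
    refine Finset.sum_congr rfl fun e _ => ?_
    conv_rhs => rw [hval e]
    split_ifs <;> simp
  rw [← hcount, ZMod.natCast_eq_zero_iff_even, ← Nat.not_odd_iff_even]
  intro hodd
  obtain ⟨C, hC⟩ := G.exists_isUnbalancedCircuit_of_isEvenSet T hT hodd
  exact hG C hC

/-- **Harary's theorem**: a balanced signed graph is switching equivalent to an all-positive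
one. -/
theorem Balanced.exists_switching [Fintype V] [Fintype E] [DecidableEq V]
    {G : SignedGraph V E} (hG : G.Balanced) :
    ∃ s : V → ℤ, (∀ v, s v = 1 ∨ s v = -1) ∧ ∀ e, G.sign e = s (G.a e) * s (G.b e) := by
  classical
  have hmem : G.negCount ∈ LinearMap.range G.boundary.dualMap := by
    rw [LinearMap.range_dualMap_eq_dualAnnihilator_ker, Submodule.mem_dualAnnihilator]
    exact fun y hy => negCount_eq_zero_of_balanced hG hy
  obtain ⟨g, hg⟩ := hmem
  set x : V → ZMod 2 := fun v => g (Pi.single v 1)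
  have hedge : ∀ e, (if G.sign e = -1 then (1 : ZMod 2) else 0) = x (G.a e) + x (G.b e) := by
    intro e
    have h := LinearMap.congr_fun hg (Pi.single e 1)
    rw [LinearMap.dualMap_apply] at h
    have h₁ : G.boundary (Pi.single e 1) = Pi.single (G.a e) 1 + Pi.single (G.b e) 1 := by
      ext v
      change ∑ e', (Pi.single e 1 : E → ZMod 2) e' * _ = _
      simp [Pi.single_apply, eq_comm]
    have h₂ : G.negCount (Pi.single e 1) = if G.sign e = -1 then 1 else 0 := by
      change ∑ e', (Pi.single e 1 : E → ZMod 2) e' * _ = _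
      simp only [Pi.single_apply, ite_mul, one_mul, zero_mul, Finset.sum_ite_eq',
        Finset.mem_univ, if_true]
    rw [h₁, h₂, map_add] at h
    exact h.symm
  refine ⟨fun v => if x v = 0 then 1 else -1, fun v => by grind, fun e => ?_⟩
  have h := hedge e
  change G.sign e = (if x (G.a e) = 0 then 1 else -1) * (if x (G.b e) = 0 then 1 else -1)
  generalize x (G.a e) = p at h ⊢
  generalize x (G.b e) = q at h ⊢
  rcases G.sign_unit e with hs | hs <;> rw [hs] at h ⊢ <;> revert p q <;> decide

theorem balanced_of_switching [Fintype V] [DecidableEq V] {G : SignedGraph V E} {s : V → ℤ}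
    (hs : ∀ v, s v = 1 ∨ s v = -1) (hsign : ∀ e, G.sign e = s (G.a e) * s (G.b e)) :
    G.Balanced := by
  rintro C ⟨⟨-, hdeg, -⟩, hodd⟩
  have h₁ : ∏ e ∈ C, G.sign e = -1 := by
    rw [← Odd.neg_one_pow hodd, ← Finset.prod_const, Finset.prod_filter]
    refine Finset.prod_congr rfl fun e _ => ?_
    rcases G.sign_unit e with h | h <;> simp [h]
  have h₂ : ∏ e ∈ C, G.sign e = ∏ v, s v ^ G.deg C v := by
    simp only [deg, ← Finset.prod_pow_eq_pow_sum]
    rw [Finset.prod_comm]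
    refine Finset.prod_congr rfl fun e _ => ?_
    simp only [hsign, pow_add, Finset.prod_mul_distrib, pow_ite, pow_one, pow_zero,
      Finset.prod_ite_eq, Finset.mem_univ, if_true]
  have h₃ : ∏ v, s v ^ G.deg C v = 1 := by
    refine Finset.prod_eq_one fun v _ => ?_
    by_cases h : G.deg C v = 0
    · rw [h, pow_zero]
    · rw [hdeg v (G.deg_ne_zero_iff.mp h)]
      rcases hs v with h | h <;> simp [h]
  omega

/-- The sum of the Kirchhoff laws, weighted by vertex coefficients. -/
lemma IsFlow.sum_smul_eq_zero [Fintype V] [Fintype E] [DecidableEq V] {Γ : Type}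
    [AddCommGroup Γ] {G : SignedGraph V E} {O : G.Orientation} {f : E → Γ}
    (hf : G.IsFlow O f) (s : V → ℤ) :
    ∑ e, (s (G.a e) * O.ηa e + s (G.b e) * O.ηb e) • f e = 0 := by
  have h : ∑ v, s v • ∑ e, ((if G.a e = v then O.ηa e else 0)
      + (if G.b e = v then O.ηb e else 0)) • f e = 0 :=
    Finset.sum_eq_zero fun v _ => by rw [hf v, smul_zero]
  simp only [Finset.smul_sum, smul_smul] at h
  rw [Finset.sum_comm] at h
  simp only [← Finset.sum_smul] at h
  simpa [mul_add, Finset.sum_add_distrib] using h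

end SignedGraph

/-- If `G` is connected and unbalanced and some edge `e` has `G - e`
balanced, then `G` has no nowhere-zero `Γ`-flow for any finite abelian group `Γ` of odd
order. -/
theorem not_flow_admissible_of_balanced_deletion {V E : Type}
    [Fintype V] [DecidableEq V] [Fintype E] [DecidableEq E]
    (G : SignedGraph V E) (O : G.Orientation)
    (hconn : G.Connected) (hunb : G.Unbalanced)
    (e : E) (hbal : (G.delete {e}).Balanced)
    (Γ : Type) [AddCommGroup Γ] [Fintype Γ] (hodd : Odd (Fintype.card Γ)) :
    ¬ ∃ f : E → Γ, G.IsFlow O f ∧ ∀ e', f e' ≠ 0 := by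
  rintro ⟨f, hf, hne⟩
  obtain ⟨s, hs, hsign⟩ := hbal.exists_switching
  have hsign' : ∀ e', e' ≠ e → G.sign e' = s (G.a e') * s (G.b e') := fun e' he' =>
    hsign ⟨e', by simpa using he'⟩
  have hsum := hf.sum_smul_eq_zero s
  rw [Finset.sum_eq_single e] at hsum
  rotate_left
  · intro e' _ he'
    have h₁ := hsign' e' he'
    have h₂ := O.compat e'
    have : s (G.a e') * O.ηa e' + s (G.b e') * O.ηb e' = 0 := by
      rcases hs (G.a e') with h | h <;> rcases hs (G.b e') with h' | h' <;>
        rcases O.ηa_unit e' with k | k <;> rcases O.ηb_unit e' with k' | k' <;>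
        simp_all
    rw [this, zero_smul]
  · simp
  have hsign_e : G.sign e ≠ s (G.a e) * s (G.b e) := by
    intro h
    obtain ⟨C, hC⟩ := hunb
    refine SignedGraph.balanced_of_switching hs (fun e' => ?_) C hC
    by_cases he' : e' = e
    · rw [he', h]
    · exact hsign' e' he'
  have htwo : s (G.a e) * O.ηa e + s (G.b e) * O.ηb e = 2 ∨
      s (G.a e) * O.ηa e + s (G.b e) * O.ηb e = -2 := by
    have h₂ := O.compat e
    rcases hs (G.a e) with h | h <;> rcases hs (G.b e) with h' | h' <;>
      rcases O.ηa_unit e with k | k <;> rcases O.ηb_unit e with k' | k' <;>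
      rw [k, k'] at h₂ <;> rw [h, h'] at hsign_e ⊢ <;> rw [k, k'] <;> omega
  have hzero : (2 : ℕ) • f e = 0 := by
    rcases htwo with h | h
    · rw [h] at hsum
      exact_mod_cast hsum
    · rw [h, neg_smul, neg_eq_zero] at hsum
      exact_mod_cast hsum
  have hcop : Nat.Coprime 2 (Fintype.card Γ) := Nat.coprime_two_left.mpr hodd
  have hord : addOrderOf (f e) ∣ 1 := by
    rw [← hcop]
    exact Nat.dvd_gcd (addOrderOf_dvd_of_nsmul_eq_zero hzero) addOrderOf_dvd_card
  exact hne e (AddMonoid.addOrderOf_eq_one_iff.mp (Nat.dvd_one.mp hord))
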